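/- Let B in {1,2}^Z be a bi-infinite sequence. Suppose that for some index j and some i in {1, ..., 13}, the word W_i occurs in B with its marked digit 2^* at position j. Then lambda_j(B) > 3.1181201786 or lambda_{j+11}(B) > 3.15. -/

import Mathlib

open Filter Set

/-- Convergents of the continued fraction `[a 0; a 1, a 2, ...]`. -/
noncomputable def cfConv : (ℕ → ℕ) → ℕ → ℝ
  | a, 0 => (a 0 : ℝ)
  | a, n + 1 => (a 0 : ℝ) + 1 / cfConv (fun i => a (i + 1)) n

/-- Value of the infinite continued fraction `[a 0; a 1, a 2, ...]`,
i.e. the limit of its convergents. -/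
noncomputable def cfVal (a : ℕ → ℕ) : ℝ := limUnder atTop (cfConv a)

/-- Value of the infinite continued fraction `[0; g 0, g 1, g 2, ...]`. -/
noncomputable def cf0 (g : ℕ → ℕ) : ℝ :=
  cfVal (fun n => match n with | 0 => 0 | k + 1 => g k)

/-- `λ_i(A) = [a_i; a_{i+1}, ...] + [0; a_{i-1}, a_{i-2}, ...]` for a bi-infinite
sequence `A`. -/
noncomputable def lam (A : ℤ → ℕ) (i : ℤ) : ℝ :=
  cfVal (fun n => A (i + n)) + cf0 (fun k => A (i - 1 - k))

/-- The Markov value `m(A) = sup_i λ_i(A)`. -/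
noncomputable def markovVal (A : ℤ → ℕ) : ℝ := sSup (Set.range (lam A))

/-- The Lagrange value `ℓ(A) = limsup_{i → +∞} λ_i(A)`. -/
noncomputable def lagrangeVal (A : ℤ → ℕ) : ℝ := limsup (lam A) atTop

/-- The Markov spectrum (Perron's characterization). -/
def MarkovSpectrum : Set ℝ :=
  {x | ∃ A : ℤ → ℕ, (∀ n, 0 < A n) ∧ BddAbove (Set.range (lam A)) ∧ x = markovVal A}

/-- The Lagrange spectrum (Perron's characterization). -/
def LagrangeSpectrum : Set ℝ :=
  {x | ∃ A : ℤ → ℕ, (∀ n, 0 < A n) ∧ IsBoundedUnder (· ≤ ·) atTop (lam A) ∧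
    x = lagrangeVal A}

/-- The purely periodic one-sided sequence with period `w`. -/
def perSeq (w : List ℕ) : ℕ → ℕ := fun n => w.getD (n % w.length) 1

/-- The one-sided sequence beginning with the finite word `p` and continuing with `g`. -/
def catSeq (p : List ℕ) (g : ℕ → ℕ) : ℕ → ℕ :=
  fun n => if n < p.length then p.getD n 1 else g (n - p.length)

/-- The eventually periodic one-sided sequence with preperiod `p` and period `w`. -/
def prePer (p w : List ℕ) : ℕ → ℕ := catSeq p (perSeq w)

/-- The periodic bi-infinite sequence with period `w`. -/
def perZ (w : List ℕ) : ℤ → ℕ := fun n => w.getD ((n % (w.length : ℤ)).toNat) 1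

/-- `c_∞ = [overline(2_4 1_2 2_2 1)] + [0; overline(1 2_2 1_2 2_4)]`. -/
noncomputable def cInf : ℝ :=
  cfVal (perSeq [2,2,2,2,1,1,2,2,1]) + cf0 (perSeq [1,2,2,1,1,2,2,2,2])

/-- `C_∞ = [2; 1, 2_2, 1_2, 2_4, 1, 2_2, 1_2, 2_4, 1, 2_2, 1_2, 2_2, 1, 2_4, 1_2,
overline(2_3 1_3)] + [0; 2_3, 1_2, 2_2, 1, 2_4, 1, overline(1_3 2_3)]`. -/
noncomputable def CInf : ℝ :=
  cfVal (prePer [2,1,2,2,1,1,2,2,2,2,1,2,2,1,1,2,2,2,2,1,2,2,1,1,2,2,1,2,2,2,2,1,1]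
    [2,2,2,1,1,1]) +
  cf0 (prePer [2,2,2,1,1,2,2,1,2,2,2,2,1] [1,1,1,2,2,2])

/-- `f = [overline(2_4 1_2 2_2 1)] + [0; 1, 2_2, 1_2, 2_4, 1, 2_2, 1_2, 2_2, 1_2,
overline(2_3 1_3)]`. -/
noncomputable def fV : ℝ :=
  cfVal (perSeq [2,2,2,2,1,1,2,2,1]) +
  cf0 (prePer [1,2,2,1,1,2,2,2,2,1,2,2,1,1,2,2,1,1] [2,2,2,1,1,1])

/-- `w` occurs in the bi-infinite sequence `A` starting at position `j`. -/
def occursAtZ (w : List ℕ) (A : ℤ → ℕ) (j : ℤ) : Prop :=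
  ∀ i : ℕ, i < w.length → A (j + i) = w.getD i 0

/-- `w` occurs somewhere in the bi-infinite sequence `A`. -/
def occursInZ (w : List ℕ) (A : ℤ → ℕ) : Prop := ∃ j : ℤ, occursAtZ w A j

/-- `w` occurs in the one-sided sequence `g` starting at position `k`. -/
def occursAtN (w : List ℕ) (g : ℕ → ℕ) (k : ℕ) : Prop :=
  ∀ i : ℕ, i < w.length → g (k + i) = w.getD i 0

/-- `w` occurs somewhere in the one-sided sequence `g`. -/
def occursInN (w : List ℕ) (g : ℕ → ℕ) : Prop := ∃ k : ℕ, occursAtN w g k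

def W1 : List ℕ := [1,2,1]
def W2 : List ℕ := [2,2,1,2,2,2,1]
def W3 : List ℕ := [2,2,2,1,2,2,2]
def W4 : List ℕ := [2,2,2,2,2,1,2,2,1,1]
def W5 : List ℕ := [2,2,2,1,1,2,2,2,2,1,2,2,1,1,2,2,2]
def W6 : List ℕ := [2,2,1,1,2,2,2,2,1,2,2,1,1,2,2,2,1]
def W7 : List ℕ := [1,1,2,2,1,1,2,2,2,2,1,2,2,1,1,2,2,2]
def W8 : List ℕ := [2,2,1,2,2,1,1,2,2,2,2,1,2,2,1,1,2,2,2,2,2]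
def W9 : List ℕ := [1,2,2,1,2,2,1,1,2,2,2,2,1,2,2,1,1,2,2,2,2,1]
def W10 : List ℕ := [2,2,2,2,1,2,2,1,1,2,2,2,2,1,2,2,1,1,2,2,2,2,1,1]
def W11 : List ℕ := [2,2,2,2,1,2,2,1,1,2,2,2,2,1,2,2,1,1,2,2,2,2,1,2,2,1,2]
def W12 : List ℕ := [1,2,2,2,2,1,2,2,1,1,2,2,2,2,1,2,2,1,1,2,2,2,2,1,2,2,1,1,1]
def W13 : List ℕ := [2,1,2,2,2,2,1,2,2,1,1,2,2,2,2,1,2,2,1,1,2,2,2,2,1,2,2,1,1,2,2]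

/-- The list of the thirteen words `W_1, …, W_13`. -/
def Wall : List (List ℕ) := [W1,W2,W3,W4,W5,W6,W7,W8,W9,W10,W11,W12,W13]

/-- The words `W_1, …, W_13` together with the (0-based) position of their marked
digit `2^*`. -/
def markedW : List (List ℕ × ℕ) :=
  [(W1,1),(W2,3),(W3,4),(W4,4),(W5,8),(W6,7),(W7,9),(W8,10),(W9,11),(W10,12),
   (W11,12),(W12,13),(W13,14)]

/-- The words `V_15, …, V_21` together with the (0-based) position of their marked
digit `2^*`. -/
def markedV : List (List ℕ × ℕ) :=
  [([1,1,2,2],2),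
   ([2,2,1,2,2,1],3),
   ([2,2,2,2,1,2,2,1,2],3),
   ([1,2,2,2,2,1,2,2,1,1,1],4),
   ([1,2,2,2,2,1,2,2,1,1,2,2,1],4),
   ([2,1,2,2,2,2,1,2,2,1,1,2,2,2],5),
   ([1,1,1,2,2,2,2,1,2,2,1,1,2,2,2],6)]

/-- The word `2 1_2 2_4 1 2_2 1_2 2_3`. -/
def spWord : List ℕ := [2,1,1,2,2,2,2,1,2,2,1,1,2,2,2]

/-- The set `P` of 27 forbidden words: `W_1, …, W_13`, their transposes, and
`2 1_2 2_4 1 2_2 1_2 2_3` together with its transpose. -/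
def Pwords : List (List ℕ) := Wall ++ Wall.map List.reverse ++ [spWord, spWord.reverse]

/-- `g` contains no word of `P` as a consecutive subword. -/
def avoidsP (g : ℕ → ℕ) : Prop := ∀ w ∈ Pwords, ¬ occursInN w g

/-- The Cantor set `Y`. -/
noncomputable def Yset : Set ℝ :=
  {x | ∃ g : ℕ → ℕ, (∀ n, g n = 1 ∨ g n = 2) ∧ avoidsP g ∧ x = cf0 g}

/-- The word `1_2 2_4 1 2_2 1_2 2_4 1 2_2 1_2 2_4 1 2_2 1_2 2_2`. -/
def bigWord : List ℕ :=
  [1,1,2,2,2,2,1,2,2,1,1,2,2,2,2,1,2,2,1,1,2,2,2,2,1,2,2,1,1,2,2]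

/-- The word `1_3 2_4 1 2_2 1_2 2_4 1 2_2 1_2 2_4 1 2_2 1_2 2_2`. -/
def bigWord13 : List ℕ := 1 :: bigWord

/-- `g` is an infinite concatenation of the blocks `(1,1)` and `(2,2)`. -/
def isBlockSeq (g : ℕ → ℕ) : Prop :=
  ∀ n, (g (2*n) = 1 ∧ g (2*n+1) = 1) ∨ (g (2*n) = 2 ∧ g (2*n+1) = 2)

/-- The Gauss–Cantor set `K({1_2, 2_2})`. -/
noncomputable def Kset : Set ℝ := {x | ∃ g : ℕ → ℕ, isBlockSeq g ∧ x = cf0 g}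

theorem one_le_cfConv {a : ℕ → ℕ} (ha : ∀ n, a n = 1 ∨ a n = 2) (n : ℕ) : 1 ≤ cfConv a n := by
  induction n generalizing a with
  | zero => rcases ha 0 with h | h <;> simp [cfConv, h]
  | succ n ih =>
    have h1 := ih fun i => ha (i + 1)
    have h2 : 0 ≤ 1 / cfConv (fun i => a (i + 1)) n := by positivity
    rcases ha 0 with h | h <;> simp only [cfConv, h] <;> push_cast <;> linarith

theorem cfConv_le_three {a : ℕ → ℕ} (ha : ∀ n, a n = 1 ∨ a n = 2) (n : ℕ) :
    cfConv a n ≤ 3 := by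
  cases n with
  | zero => rcases ha 0 with h | h <;> norm_num [cfConv, h]
  | succ n =>
    have h1 : 1 / cfConv (fun i => a (i + 1)) n ≤ 1 :=
      div_le_one_of_le₀ (one_le_cfConv (fun i => ha (i + 1)) n)
        (zero_le_one.trans (one_le_cfConv (fun i => ha (i + 1)) n))
    rcases ha 0 with h | h <;> simp only [cfConv, h] <;> push_cast <;> linarith

theorem four_thirds_le_cfConv_succ {a : ℕ → ℕ} (ha : ∀ n, a n = 1 ∨ a n = 2) (n : ℕ) :
    4 / 3 ≤ cfConv a (n + 1) := by
  have h1 := one_le_cfConv (fun i => ha (i + 1)) n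
  have h2 : 1 / 3 ≤ 1 / cfConv (fun i => a (i + 1)) n :=
    one_div_le_one_div_of_le (by linarith) (cfConv_le_three (fun i => ha (i + 1)) n)
  rcases ha 0 with h | h <;> simp only [cfConv, h] <;> push_cast <;> linarith

theorem dist_cfConv_succ_le {a : ℕ → ℕ} (ha : ∀ n, a n = 1 ∨ a n = 2) (n : ℕ) :
    dist (cfConv a n) (cfConv a (n + 1)) ≤ 1 * (3 / 4) ^ n := by
  induction n generalizing a with
  | zero => rcases ha 1 with h | h <;> norm_num [cfConv, h, Real.dist_eq]
  | succ n ih =>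
    have hd := ih fun i => ha (i + 1)
    have hx := one_le_cfConv (fun i => ha (i + 1)) n
    have hy := four_thirds_le_cfConv_succ (fun i => ha (i + 1)) n
    rw [Real.dist_eq] at hd ⊢
    rw [cfConv, cfConv.eq_2 a (n + 1)]
    set x := cfConv (fun i => a (i + 1)) n
    set y := cfConv (fun i => a (i + 1)) (n + 1)
    have hxy : 4 / 3 ≤ x * y := by nlinarith
    have key : ((a 0 : ℝ) + 1 / x) - (a 0 + 1 / y) = -(x - y) / (x * y) := by
      field_simp
      ring
    rw [key, abs_div, abs_neg, abs_of_pos (by linarith : 0 < x * y), div_le_iff₀ (by linarith)]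
    have hp : (0 : ℝ) ≤ (3 / 4) ^ n := by positivity
    rw [pow_succ]
    nlinarith

theorem tendsto_cfConv {a : ℕ → ℕ} (ha : ∀ n, a n = 1 ∨ a n = 2) :
    Tendsto (cfConv a) atTop (nhds (cfVal a)) :=
  (cauchySeq_of_le_geometric _ _ (by norm_num) (dist_cfConv_succ_le ha)).tendsto_limUnder

theorem cfVal_mem_Icc {a : ℕ → ℕ} (ha : ∀ n, a n = 1 ∨ a n = 2) : cfVal a ∈ Icc (1 : ℝ) 3 :=
  ⟨ge_of_tendsto' (tendsto_cfConv ha) (one_le_cfConv ha),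
    le_of_tendsto' (tendsto_cfConv ha) (cfConv_le_three ha)⟩

theorem tendsto_cfConv_succ {a : ℕ → ℕ} (ha : ∀ n, a (n + 1) = 1 ∨ a (n + 1) = 2) :
    Tendsto (cfConv a) atTop (nhds (a 0 + 1 / cfVal fun n => a (n + 1))) := by
  rw [← tendsto_add_atTop_iff_nat 1]
  have h := (cfVal_mem_Icc ha).1
  exact tendsto_const_nhds.add (tendsto_const_nhds.div (tendsto_cfConv ha) (by linarith))

theorem cf0_eq {g : ℕ → ℕ} (hg : ∀ n, g n = 1 ∨ g n = 2) : cf0 g = 1 / cfVal g := by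
  refine (tendsto_cfConv_succ (a := fun n => match n with | 0 => 0 | k + 1 => g k)
    hg).limUnder_eq.trans ?_
  simp

theorem cfVal_eq {g : ℕ → ℕ} (hg : ∀ n, g n = 1 ∨ g n = 2) :
    cfVal g = g 0 + cf0 fun n => g (n + 1) := by
  rw [cf0_eq fun n => hg (n + 1)]
  exact (tendsto_cfConv_succ fun n => hg (n + 1)).limUnder_eq

theorem cf0_eq_one_div {g : ℕ → ℕ} (hg : ∀ n, g n = 1 ∨ g n = 2) :
    cf0 g = 1 / (g 0 + cf0 fun n => g (n + 1)) := by
  rw [cf0_eq hg, cfVal_eq hg]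

theorem cf0_mem_Icc_of_tail {g : ℕ → ℕ} (hg : ∀ n, g n = 1 ∨ g n = 2) {l u : ℝ} (hl : 0 < l)
    (h : (cf0 fun n => g (n + 1)) ∈ Icc l u) :
    cf0 g ∈ Icc (1 / (g 0 + u)) (1 / (g 0 + l)) := by
  have h0 : (0 : ℝ) ≤ g 0 := Nat.cast_nonneg _
  rw [cf0_eq_one_div hg]
  exact ⟨one_div_le_one_div_of_le (by linarith [h.1]) (by linarith [h.2]),
    one_div_le_one_div_of_le (by linarith) (by linarith [h.1])⟩

theorem cf0_mem_Icc_of_forall {l u l' u' : ℝ} (hl : 0 < l) (hu : 0 ≤ u)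
    (hl' : l' ≤ 1 / (2 + u)) (hu' : 1 / (1 + l) ≤ u')
    (h : ∀ g : ℕ → ℕ, (∀ n, g n = 1 ∨ g n = 2) → cf0 g ∈ Icc l u)
    (g : ℕ → ℕ) (hg : ∀ n, g n = 1 ∨ g n = 2) : cf0 g ∈ Icc l' u' := by
  have hd : (1 : ℝ) ≤ g 0 ∧ (g 0 : ℝ) ≤ 2 := by rcases hg 0 with h | h <;> norm_num [h]
  have ht := cf0_mem_Icc_of_tail hg hl (h _ fun n => hg (n + 1))
  exact ⟨hl'.trans ((one_div_le_one_div_of_le (by linarith) (by linarith)).trans ht.1),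
    (ht.2.trans (one_div_le_one_div_of_le (by linarith) (by linarith))).trans hu'⟩

theorem cf0_mem_Icc (g : ℕ → ℕ) (hg : ∀ n, g n = 1 ∨ g n = 2) :
    cf0 g ∈ Icc (4 / 11 : ℝ) (11 / 15) := by
  have h0 : ∀ g : ℕ → ℕ, (∀ n, g n = 1 ∨ g n = 2) → cf0 g ∈ Icc (1 / 3 : ℝ) 1 := by
    intro g hg
    have h := cfVal_mem_Icc hg
    rw [cf0_eq hg]
    exact ⟨one_div_le_one_div_of_le (by linarith [h.1]) h.2,
      div_le_one_of_le₀ h.1 (by linarith [h.1])⟩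
  have h1 : ∀ g : ℕ → ℕ, (∀ n, g n = 1 ∨ g n = 2) → cf0 g ∈ Icc (1 / 3 : ℝ) (3 / 4) :=
    cf0_mem_Icc_of_forall (by norm_num) (by norm_num) (by norm_num) (by norm_num) h0
  have h2 : ∀ g : ℕ → ℕ, (∀ n, g n = 1 ∨ g n = 2) → cf0 g ∈ Icc (4 / 11 : ℝ) (3 / 4) :=
    cf0_mem_Icc_of_forall (by norm_num) (by norm_num) (by norm_num) (by norm_num) h1
  exact cf0_mem_Icc_of_forall (by norm_num) (by norm_num) (by norm_num) (by norm_num) h2 g hg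

/-- Endpoints of an interval containing every `[0; w, x, y, ...]` with `x, y, ... ∈ {1, 2}`. -/
def cfEnclosure : List ℕ → ℚ × ℚ
  | [] => (4 / 11, 11 / 15)
  | d :: w => (1 / (d + (cfEnclosure w).2), 1 / (d + (cfEnclosure w).1))

theorem cfEnclosure_pos (w : List ℕ) : 0 < (cfEnclosure w).1 ∧ 0 < (cfEnclosure w).2 := by
  induction w with
  | nil => norm_num [cfEnclosure]
  | cons d w ih =>
    obtain ⟨h1, h2⟩ := ih
    exact ⟨by simp only [cfEnclosure]; positivity, by simp only [cfEnclosure]; positivity⟩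

theorem cf0_mem_cfEnclosure (w : List ℕ) {g : ℕ → ℕ} (hg : ∀ n, g n = 1 ∨ g n = 2)
    (hw : ∀ i < w.length, g i = w.getD i 0) :
    cf0 g ∈ Icc ((cfEnclosure w).1 : ℝ) (cfEnclosure w).2 := by
  induction w generalizing g with
  | nil => simpa [cfEnclosure] using cf0_mem_Icc g hg
  | cons d w ih =>
    have ht := ih (fun n => hg (n + 1)) fun i hi => by
      simpa using hw (i + 1) (by simpa using hi)
    have h0 : g 0 = d := by simpa using hw 0 (by simp)
    have := cf0_mem_Icc_of_tail hg (by exact_mod_cast (cfEnclosure_pos w).1) ht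
    rw [h0] at this
    simpa [cfEnclosure] using this

theorem le_lam_of_occursAtZ {B : ℤ → ℕ} (hB : ∀ n, B n = 1 ∨ B n = 2) {j : ℤ} (u : List ℕ)
    (d : ℕ) (v : List ℕ) (h : occursAtZ (u.reverse ++ d :: v) B (j - u.length)) :
    (d : ℝ) + (cfEnclosure v).1 + (cfEnclosure u).1 ≤ lam B j := by
  have hd : B j = d := by simpa using h u.length (by simp)
  have hv := (cf0_mem_cfEnclosure v (g := fun n => B (j + (n + 1 : ℕ))) (fun n => hB _)
    fun i hi => by
      have := h (u.length + 1 + i) (by simp; omega)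
      rw [List.getD_append_right _ _ _ _ (by simp; omega)] at this
      simp only [List.length_reverse, show u.length + 1 + i - u.length = i + 1 by omega,
        List.getD_cons_succ] at this
      rw [← this]
      congr 1
      push_cast
      ring).1
  have hu := (cf0_mem_cfEnclosure u (g := fun n => B (j - 1 - n)) (fun n => hB _)
    fun i hi => by
      have := h (u.length - 1 - i) (by simp; omega)
      rw [List.getD_append _ _ _ _ (by simp; omega), List.getD_reverse _ (by omega),
        show u.length - 1 - (u.length - 1 - i) = i by omega] at this
      rw [← this]
      congr 1
      omega).1
  have hj : lam B j = d + (cf0 fun n => B (j + (n + 1 : ℕ))) + cf0 fun n => B (j - 1 - n) := by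
    rw [lam, cfVal_eq fun n => hB _]
    simp [hd]
  rw [hj]
  exact add_le_add (add_le_add le_rfl hv) hu

theorem occursAtZ_append_singleton {w : List ℕ} {B : ℤ → ℕ} {k : ℤ} {d : ℕ}
    (h : occursAtZ w B k) (hd : B (k + w.length) = d) : occursAtZ (w ++ [d]) B k := by
  intro i hi
  rcases Nat.lt_or_ge i w.length with hlt | hge
  · rw [List.getD_append _ _ _ _ hlt, h i hlt]
  · obtain rfl : i = w.length := by simp at hi; omega
    simp [hd]

theorem lt_lam_of_occursAtZ {B : ℤ → ℕ} (hB : ∀ n, B n = 1 ∨ B n = 2) {j : ℤ} (w : List ℕ)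
    (p : ℕ) {t : ℚ} (h : occursAtZ w B (j - p)) (hp : p < w.length)
    (ht : t < w[p] + (cfEnclosure (w.drop (p + 1))).1 + (cfEnclosure (w.take p).reverse).1) :
    (t : ℝ) < lam B j := by
  refine lt_of_lt_of_le ?_ (le_lam_of_occursAtZ hB (w.take p).reverse w[p] (w.drop (p + 1)) ?_)
  · exact_mod_cast ht
  · simpa [hp.le] using h

theorem lt_lam_of_occursAtZ_W9 {B : ℤ → ℕ} (hB : ∀ n, B n = 1 ∨ B n = 2) {j : ℤ}
    (h : occursAtZ W9 B (j - 11)) :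
    3.1181201786 < lam B j ∨ 3.15 < lam B (j + 11) := by
  rcases hB (j - 11 + W9.length) with h1 | h1
  · left
    have := lt_lam_of_occursAtZ hB (t := 3.1181201786) _ 11 (occursAtZ_append_singleton h h1)
      (by simp [W9]) (by norm_num [W9, cfEnclosure])
    exact_mod_cast this
  have h2 := occursAtZ_append_singleton h h1
  rcases hB (j - 11 + (W9 ++ [2]).length) with h3 | h3
  · right
    have h4 := occursAtZ_append_singleton h2 h3
    have h5 : occursAtZ W1 B (j + 11 - (1 : ℕ)) := by
      intro i hi
      have := h4 (i + 21) (by simp [W9, W1] at hi ⊢; omega)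
      rw [show j + 11 - ((1 : ℕ) : ℤ) + i = j - 11 + (i + 21 : ℕ) by push_cast; ring, this]
      simp only [W1, List.length_cons, List.length_nil] at hi
      interval_cases i <;> rfl
    have := lt_lam_of_occursAtZ hB (t := 3.15) W1 1 h5 (by simp [W1])
      (by norm_num [W1, cfEnclosure])
    exact_mod_cast this
  · left
    have := lt_lam_of_occursAtZ hB (t := 3.1181201786) _ 11 (occursAtZ_append_singleton h2 h3)
      (by simp [W9]) (by norm_num [W9, cfEnclosure])
    exact_mod_cast this

/-- forbidden strings. -/
theorem forbidden_strings (B : ℤ → ℕ) (hB : ∀ n, B n = 1 ∨ B n = 2) (j : ℤ)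
    (h : ∃ p ∈ markedW, occursAtZ p.1 B (j - (p.2 : ℤ))) :
    3.1181201786 < lam B j ∨ 3.15 < lam B (j + 11) := by
  obtain ⟨⟨w, p⟩, hp, h⟩ := h
  by_cases h9 : (w, p) = (W9, 11)
  · obtain ⟨rfl, rfl⟩ := Prod.mk.inj h9
    exact lt_lam_of_occursAtZ_W9 hB h
  left
  have hlt : ∃ hlen : p < w.length, (3.1181201786 : ℚ) <
      w[p] + (cfEnclosure (w.drop (p + 1))).1 + (cfEnclosure (w.take p).reverse).1 := by
    simp only [markedW, List.mem_cons, List.not_mem_nil, or_false] at hp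
    rcases hp with hp | hp | hp | hp | hp | hp | hp | hp | hp | hp | hp | hp | hp
    case inr.inr.inr.inr.inr.inr.inr.inr.inl => exact absurd hp h9
    all_goals
      obtain ⟨rfl, rfl⟩ := Prod.mk.inj hp
      refine ⟨by simp [W1, W2, W3, W4, W5, W6, W7, W8, W10, W11, W12, W13], ?_⟩
      norm_num [cfEnclosure, W1, W2, W3, W4, W5, W6, W7, W8, W10, W11, W12, W13]
  obtain ⟨hlen, ht⟩ := hlt
  exact_mod_cast lt_lam_of_occursAtZ hB w p h hlen ht
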